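/- Let H be a Hausdorff topological group which is connected and simply connected, let G be a dense subgroup of H acting on H by left translation, and let V ⊆ X ⊆ H where V is open, path-connected and a G-covering (⋃_{g∈G} gV = H). Put V' = V ∩ G and X' = X ∩ G. Then the homomorphism ψ_{V'}^{X'} : 𝐆(G,V') → 𝐆(G,X') is injective. -/

import Mathlib

open Pointwise

/-- `E(V) = {g ∈ G : V ∩ g•V ≠ ∅}`. -/
def Eset (G : Type*) {M : Type*} [Group G] [MulAction G M] (V : Set M) : Set G :=
  {g | (V ∩ g • V).Nonempty}

/-- `F'(V) = {(g,h) : V ∩ g•V ∩ (g*h)•V ≠ ∅}`. -/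
def Fset (G : Type*) {M : Type*} [Group G] [MulAction G M] (V : Set M) : Set (G × G) :=
  {p | (V ∩ p.1 • V ∩ (p.1 * p.2) • V).Nonempty}

/-- The relators `(g)(h)((g*h))⁻¹` with `(g,h) ∈ F'(V)`. -/
def relatorSet (G : Type*) {M : Type*} [Group G] [MulAction G M] (V : Set M) :
    Set (FreeGroup ↥(Eset G V)) :=
  {r | ∃ g h gh : ↥(Eset G V), ((g : G), (h : G)) ∈ Fset G V ∧ (gh : G) = (g : G) * h ∧
       r = FreeGroup.of g * FreeGroup.of h * (FreeGroup.of gh)⁻¹}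

/-- The group `𝐆(G,V)`: the free group on `E(V)` modulo the normal closure of the relators. -/
abbrev GGrp (G : Type*) {M : Type*} [Group G] [MulAction G M] (V : Set M) : Type _ :=
  FreeGroup ↥(Eset G V) ⧸ Subgroup.normalClosure (relatorSet G V)

/-- The class of a generator `g ∈ E(V)` in `𝐆(G,V)`. -/
def GGrp.gen (G : Type*) {M : Type*} [Group G] [MulAction G M] (V : Set M)
    (g : ↥(Eset G V)) : GGrp G V :=
  QuotientGroup.mk (FreeGroup.of g)

theorem Eset_mono {G M : Type*} [Group G] [MulAction G M] {U V : Set M} (h : U ⊆ V) :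
    Eset G U ⊆ Eset G V := by
  rintro g ⟨x, hx1, hx2⟩
  exact ⟨x, h hx1, Set.smul_set_mono h hx2⟩

theorem Fset_mono {G M : Type*} [Group G] [MulAction G M] {U V : Set M} (h : U ⊆ V) :
    Fset G U ⊆ Fset G V := by
  rintro ⟨g, g'⟩ ⟨x, ⟨hx1, hx2⟩, hx3⟩
  exact ⟨x, ⟨h hx1, Set.smul_set_mono h hx2⟩, Set.smul_set_mono h hx3⟩

/-- `ψ_U^V : 𝐆(G,U) → 𝐆(G,V)`, induced on generators by the inclusion `E(U) ⊆ E(V)`. -/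
def psi (G : Type*) {M : Type*} [Group G] [MulAction G M] {U V : Set M} (hUV : U ⊆ V) :
    GGrp G U →* GGrp G V :=
  QuotientGroup.lift _
    ((QuotientGroup.mk' (Subgroup.normalClosure (relatorSet G V))).comp
      (FreeGroup.map (fun g => (⟨(g : G), Eset_mono hUV g.2⟩ : ↥(Eset G V))))) <| by
    intro x hx
    set φ := (QuotientGroup.mk' (Subgroup.normalClosure (relatorSet G V))).comp
      (FreeGroup.map (fun g : ↥(Eset G U) => (⟨(g : G), Eset_mono hUV g.2⟩ : ↥(Eset G V))))
    have hsub : relatorSet G U ⊆ (φ.ker : Set (FreeGroup ↥(Eset G U))) := by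
      rintro r ⟨g, h, gh, hF, hmul, rfl⟩
      have : φ (FreeGroup.of g * FreeGroup.of h * (FreeGroup.of gh)⁻¹) = 1 := by
        simp only [φ, MonoidHom.comp_apply, map_mul, map_inv, FreeGroup.map.of]
        apply (QuotientGroup.eq_one_iff _).mpr
        apply Subgroup.subset_normalClosure
        exact ⟨_, _, _, Fset_mono hUV hF, hmul, rfl⟩
      exact this
    exact (Subgroup.normalClosure_le_normal hsub) hx

@[simp] theorem psi_gen {G M : Type*} [Group G] [MulAction G M] {U V : Set M} (hUV : U ⊆ V)
    (g : ↥(Eset G U)) :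
    psi G hUV (GGrp.gen G U g) = GGrp.gen G V ⟨(g : G), Eset_mono hUV g.2⟩ := rfl

/-- The evaluation homomorphism `ε_V : 𝐆(G,V) → G`. -/
def evalHom (G : Type*) {M : Type*} [Group G] [MulAction G M] (V : Set M) :
    GGrp G V →* G :=
  QuotientGroup.lift _ (FreeGroup.lift (fun g : ↥(Eset G V) => (g : G))) <| by
    intro x hx
    have hsub : relatorSet G V ⊆
        ((FreeGroup.lift (fun g : ↥(Eset G V) => (g : G))).ker :
          Set (FreeGroup ↥(Eset G V))) := by
      rintro r ⟨g, h, gh, hF, hmul, rfl⟩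
      have : FreeGroup.lift (fun g : ↥(Eset G V) => (g : G))
          (FreeGroup.of g * FreeGroup.of h * (FreeGroup.of gh)⁻¹) = 1 := by
        rw [map_mul, map_mul, map_inv, FreeGroup.lift_apply_of, FreeGroup.lift_apply_of,
          FreeGroup.lift_apply_of, hmul]
        group
      exact this
    exact (Subgroup.normalClosure_le_normal hsub) hx

@[simp] theorem evalHom_gen {G M : Type*} [Group G] [MulAction G M] (V : Set M)
    (g : ↥(Eset G V)) : evalHom G V (GGrp.gen G V g) = (g : G) := by
  simp [evalHom, GGrp.gen, FreeGroup.lift_apply_of]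


theorem IsCoveringMap.eq_of_joined {E B : Type*} [TopologicalSpace E] [TopologicalSpace B]
    [SimplyConnectedSpace B] {p : E → B} (cov : IsCoveringMap p) {a b : E} (h : Joined a b)
    (hab : p a = p b) : a = b := by
  obtain ⟨γ⟩ := h
  let γ' : Path (p a) (p a) := (γ.map cov.continuous).cast rfl hab
  have key := cov.liftPath_apply_one_eq_of_homotopicRel
    (SimplyConnectedSpace.paths_homotopic γ' (Path.refl (p a))) a γ'.source rfl
  have hγ : (γ : C(unitInterval, E)) = cov.liftPath γ' a γ'.source :=
    (cov.eq_liftPath_iff' _).mpr ⟨rfl, γ.source⟩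
  have hconst : cov.liftPath (Path.refl (p a)) a rfl = .const unitInterval a :=
    cov.liftPath_const rfl
  exact (γ.target.symm.trans <| (DFunLike.congr_fun hγ 1).trans <| key.trans <|
    DFunLike.congr_fun hconst 1).symm

theorem mem_Fset_of_mem_smul {G M : Type*} [Group G] [MulAction G M] {V : Set M}
    {i j k : G} {x : M} (hi : x ∈ i • V) (hj : x ∈ j • V) (hk : x ∈ k • V) : (k⁻¹ * j, j⁻¹ * i) ∈ Fset G V := by
  have h (l : G) (hl : x ∈ l • V) : k⁻¹ • x ∈ (k⁻¹ * l) • V := by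
    rw [mul_smul]
    exact Set.smul_mem_smul_set hl
  refine ⟨k⁻¹ • x, ⟨by simpa using h k hk, h j hj⟩, ?_⟩
  have := h i hi
  rwa [show k⁻¹ * i = k⁻¹ * j * (j⁻¹ * i) by group] at this

section Macbeath

variable {G M A : Type*} [Group G] [MulAction G M] [TopologicalSpace M] [ContinuousConstSMul G M]
  [Group A] [TopologicalSpace A] [DiscreteTopology A]

/-- The principal bundle over `M` with trivializing open sets `g • V` and transition functions
`c (j⁻¹ * i)`, where `c : G → A` is multiplicative on `F'(V)`. -/
noncomputable def translateBundleCore {V : Set M} (hV : IsOpen V)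
    (hcov : (⋃ g : G, g • V) = Set.univ) (c : G → A)
    (hc : ∀ g h : G, (g, h) ∈ Fset G V → c g * c h = c (g * h)) : FiberBundleCore G M A where
  baseSet g := g • V
  isOpen_baseSet g := hV.smul g
  indexAt x := (Set.mem_iUnion.mp (hcov.symm ▸ Set.mem_univ x : x ∈ ⋃ g : G, g • V)).choose
  mem_baseSet_at x :=
    (Set.mem_iUnion.mp (hcov.symm ▸ Set.mem_univ x : x ∈ ⋃ g : G, g • V)).choose_spec
  coordChange i j _ v := c (j⁻¹ * i) * v
  coordChange_self i x hx v := by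
    have := hc _ _ (mem_Fset_of_mem_smul hx hx hx)
    simpa using this
  continuousOn_coordChange i j :=
    ((continuous_of_discreteTopology (f := fun v : A => c (j⁻¹ * i) * v)).comp
      continuous_snd).continuousOn
  coordChange_comp i j k x hx v := by
    rw [← mul_assoc, hc _ _ (mem_Fset_of_mem_smul hx.1.1 hx.1.2 hx.2)]
    group

theorem eq_one_of_mem_closure_graph [SimplyConnectedSpace M] {V : Set M} (hV : IsOpen V)
    (hVpc : IsPathConnected V) (hcov : (⋃ g : G, g • V) = Set.univ) (c : G → A)
    (hc : ∀ g h : G, (g, h) ∈ Fset G V → c g * c h = c (g * h)) {a : A}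
    (ha : ((1 : G), a) ∈ Subgroup.closure ((fun g => (g, c g)) '' Eset G V)) : a = 1 := by
  let Z := translateBundleCore hV hcov c hc
  let s (g : G) (v : A) (x : M) : Z.TotalSpace :=
    (Z.localTriv g).toOpenPartialHomeomorph.symm (x, v)
  have hs_chart {g : G} (v : A) {x : M} (hx : x ∈ g • V) : Z.localTriv g (s g v x) = (x, v) :=
    (Z.localTriv g).apply_symm_apply ((Z.localTriv g).mem_target.mpr hx)
  have hs_cont (g : G) (v : A) : ContinuousOn (s g v) (g • V) :=
    (Z.localTriv g).toOpenPartialHomeomorph.symm.continuousOn.comp (by fun_prop)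
      fun x hx => (Z.localTriv g).mem_target.mpr hx
  have hs_joined (g : G) (v : A) {x y : M} (hx : x ∈ g • V) (hy : y ∈ g • V) :
      Joined (s g v x) (s g v y) :=
    (((hVpc.image (continuous_const_smul g)).image' (hs_cont g v)).joinedIn _
      (Set.mem_image_of_mem _ hx) _ (Set.mem_image_of_mem _ hy)).joined
  have hs_change {g g' : G} (v : A) {x : M} (hx : x ∈ g • V) (hx' : x ∈ g' • V) :
      s g' v x = s g (c (g⁻¹ * g') * v) x := by
    have := Z.coordChange_comp g' g (Z.indexAt x) x ⟨⟨hx', hx⟩, Z.mem_baseSet_at x⟩ v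
    exact congrArg (Bundle.TotalSpace.mk x) this.symm
  have hne (g : G) : (g • V).Nonempty := hVpc.nonempty.smul_set
  have key : ∀ q ∈ Subgroup.closure ((fun g => (g, c g)) '' Eset G V), ∀ (g : G) (v : A),
      ∀ x ∈ (g * q.1) • V, ∀ y ∈ g • V, Joined (s (g * q.1) v x) (s g (q.2 * v) y) := by
    intro q hq
    induction hq using Subgroup.closure_induction with
    | mem q hq =>
      obtain ⟨e, ⟨z, hz, hz'⟩, rfl⟩ := hq
      intro g v x hx y hy
      have hgz : g • z ∈ g • V := Set.smul_mem_smul_set hz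
      have hgz' : g • z ∈ (g * e) • V := by
        rw [mul_smul]
        exact Set.smul_mem_smul_set hz'
      have h := hs_joined (g * e) v hx hgz'
      rw [hs_change v hgz hgz', inv_mul_cancel_left] at h
      exact h.trans (hs_joined g _ hgz hy)
    | one =>
      intro g v x hx y hy
      simp only [Prod.fst_one, Prod.snd_one, mul_one, one_mul] at hx ⊢
      exact hs_joined g v hx hy
    | mul q r _ _ ihq ihr =>
      intro g v x hx y hy
      obtain ⟨z, hz⟩ := hne (g * q.1)
      simp only [Prod.fst_mul, Prod.snd_mul, ← mul_assoc] at hx ⊢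
      have h := ihq g (r.2 * v) z hz y hy
      rw [← mul_assoc] at h
      exact (ihr (g * q.1) v x hx z hz).trans h
    | inv q _ ih =>
      intro g v x hx y hy
      have h := ih (g * q.1⁻¹) (q.2⁻¹ * v) y (by simpa using hy) x hx
      simp only [inv_mul_cancel_right, mul_inv_cancel_left] at h
      exact h.symm
  obtain ⟨x, hx⟩ := hne 1
  have h := key _ ha 1 1 x (by simpa using hx) x hx
  simp only [mul_one] at h
  have heq : s 1 1 x = s 1 a x :=
    (FiberBundle.isCoveringMap (F := A) (E := Z.Fiber)).eq_of_joined h rfl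
  have h2 := congrArg (Z.localTriv 1) heq
  rw [hs_chart 1 hx, hs_chart a hx] at h2
  exact (congrArg Prod.snd h2).symm

end Macbeath

theorem GGrp.gen_mul_gen {G M : Type*} [Group G] [MulAction G M] {W : Set M}
    {g h gh : ↥(Eset G W)} (hF : ((g : G), (h : G)) ∈ Fset G W) (hgh : (gh : G) = g * h) :
    GGrp.gen G W g * GGrp.gen G W h = GGrp.gen G W gh := by
  have : (QuotientGroup.mk (FreeGroup.of g * FreeGroup.of h * (FreeGroup.of gh)⁻¹) :
      GGrp G W) = 1 :=
    (QuotientGroup.eq_one_iff _).mpr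
      (Subgroup.subset_normalClosure ⟨g, h, gh, hF, hgh, rfl⟩)
  exact mul_inv_eq_one.mp this

theorem GGrp.closure_range_gen {G M : Type*} [Group G] [MulAction G M] (W : Set M) :
    Subgroup.closure (Set.range (GGrp.gen G W)) = ⊤ := by
  have h := congrArg (Subgroup.map (QuotientGroup.mk' (Subgroup.normalClosure (relatorSet G W))))
    (FreeGroup.closure_range_of ↥(Eset G W))
  rw [MonoidHom.map_closure, ← Set.range_comp, ← MonoidHom.range_eq_map,
    MonoidHom.range_eq_top.mpr (QuotientGroup.mk'_surjective _)] at h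
  exact h

/-- Macbeath's theorem, for the presentation attached to a subset `W ⊆ V` having the same double
and triple overlaps of translates as `V`. -/
theorem evalHom_injective {G M : Type*} [Group G] [MulAction G M] [TopologicalSpace M]
    [ContinuousConstSMul G M] [SimplyConnectedSpace M] {V W : Set M} (hV : IsOpen V)
    (hVpc : IsPathConnected V) (hcov : (⋃ g : G, g • V) = Set.univ) (hWV : W ⊆ V)
    (hF : Fset G V ⊆ Fset G W) : Function.Injective (evalHom G W) := by
  classical
  let c (g : G) : GGrp G W := if h : g ∈ Eset G W then GGrp.gen G W ⟨g, h⟩ else 1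
  have hc_gen (g : ↥(Eset G W)) : c g = GGrp.gen G W g := dif_pos g.2
  have hc (g h : G) (hgh : (g, h) ∈ Fset G V) : c g * c h = c (g * h) := by
    obtain ⟨x, ⟨h1, h2⟩, h3⟩ := hF hgh
    have hg : g ∈ Eset G W := ⟨x, h1, h2⟩
    have hgh' : g * h ∈ Eset G W := ⟨x, h1, h3⟩
    have hh : h ∈ Eset G W := by
      refine ⟨g⁻¹ • x, Set.mem_smul_set_iff_inv_smul_mem.mp h2, ?_⟩
      have := Set.smul_mem_smul_set (a := g⁻¹) h3
      rwa [mul_smul, inv_smul_smul] at this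
    rw [hc_gen ⟨g, hg⟩, hc_gen ⟨h, hh⟩, hc_gen ⟨g * h, hgh'⟩]
    exact GGrp.gen_mul_gen (hF hgh) rfl
  let _ : TopologicalSpace (GGrp G W) := ⊥
  have : DiscreteTopology (GGrp G W) := ⟨rfl⟩
  have hgraph (q : GGrp G W) :
      (evalHom G W q, q) ∈ Subgroup.closure ((fun g => (g, c g)) '' Eset G V) := by
    have hle : Subgroup.closure (Set.range (GGrp.gen G W)) ≤
        (Subgroup.closure ((fun g => (g, c g)) '' Eset G V)).comap
          ((evalHom G W).prod (MonoidHom.id _)) := by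
      rw [Subgroup.closure_le]
      rintro _ ⟨g, rfl⟩
      refine Subgroup.subset_closure ⟨(g : G), Eset_mono (G := G) hWV g.2, ?_⟩
      simp [hc_gen]
    exact hle ((GGrp.closure_range_gen (G := G) W).symm ▸ Subgroup.mem_top q)
  rw [injective_iff_map_eq_one]
  intro q hq
  exact eq_one_of_mem_closure_graph hV hVpc hcov c hc (hq ▸ hgraph q)

theorem evalHom_psi {G M : Type*} [Group G] [MulAction G M] {U V : Set M} (hUV : U ⊆ V)
    (q : GGrp G U) : evalHom G V (psi G hUV q) = evalHom G U q := by
  have h : (evalHom G V).comp (psi G hUV) = evalHom G U := by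
    refine MonoidHom.eq_of_eqOn_dense (GGrp.closure_range_gen U) ?_
    rintro _ ⟨g, rfl⟩
    simp
  exact DFunLike.congr_fun h q

theorem Fset_subset_Fset_inter {H : Type*} [TopologicalSpace H] [Group H] [IsTopologicalGroup H]
    (G : Subgroup H) (hdense : Dense (G : Set H)) {V : Set H} (hV : IsOpen V) :
    Fset ↥G V ⊆ Fset ↥G (V ∩ (G : Set H)) := by
  rintro ⟨g, h⟩ hgh
  obtain ⟨y, ⟨⟨h1, h2⟩, h3⟩, hyG⟩ :=
    hdense.inter_open_nonempty _ ((hV.inter (hV.smul g)).inter (hV.smul (g * h))) hgh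
  have hmem (k : ↥G) (hk : y ∈ k • V) : y ∈ k • (V ∩ (G : Set H)) := by
    rw [Set.mem_smul_set_iff_inv_smul_mem] at hk ⊢
    exact ⟨hk, G.mul_mem (k⁻¹).2 hyG⟩
  exact ⟨y, ⟨⟨h1, hyG⟩, hmem g h2⟩, hmem (g * h) h3⟩

/-- With `H` Hausdorff, connected, simply connected, `G ≤ H` dense, `V ⊆ X ⊆ H`, `V` open,
path-connected and a `G`-covering, the map `ψ_{V'}^{X'} : 𝐆(G,V∩G) → 𝐆(G,X∩G)` is
injective. -/
theorem psi_inter_injective {H : Type*} [TopologicalSpace H] [Group H]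
    [IsTopologicalGroup H] [T2Space H] [ConnectedSpace H] [SimplyConnectedSpace H]
    (G : Subgroup H) (hdense : Dense (G : Set H))
    {V X : Set H} (hVX : V ⊆ X)
    (hVopen : IsOpen V) (hVpc : IsPathConnected V)
    (hcov : (⋃ g : ↥G, g • V) = (Set.univ : Set H)) :
    Function.Injective
      (psi ↥G (Set.inter_subset_inter_left (G : Set H) hVX) :
        GGrp ↥G (V ∩ (G : Set H)) →* GGrp ↥G (X ∩ (G : Set H))) := by
  intro p q hpq
  refine evalHom_injective hVopen hVpc hcov Set.inter_subset_left
    (Fset_subset_Fset_inter G hdense hVopen) ?_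
  rw [← evalHom_psi (Set.inter_subset_inter_left (G : Set H) hVX), hpq, evalHom_psi]
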